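/- arXiv:1908.06697 — 4 statements merged into one kernel-verified Lean document; each statement's English description precedes it below -/
import Mathlib

section
/- Let G be a subcubic simple graph and suppose H is an induced subgraph of G, on vertices v0,...,v7. Then in every good coloring of G, at most one of the vertices v0 and v1 is colored red. -/
/-- A 2-coloring of the vertices is encoded by `red : V → Prop`;
`red v` means `v` is colored red, otherwise `v` is blue.
A *good coloring* requires:
(1) the subgraph induced by blue vertices has maximum degree at most 1,
(2) the subgraph induced by red vertices has minimum degree at least 1,
(3) the subgraph induced by red vertices contains no path on 4 vertices. -/
def IsGoodColoring {V : Type*} (G : SimpleGraph V) (red : V → Prop) : Prop :=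
  (∀ v w₁ w₂ : V, ¬ red v → ¬ red w₁ → ¬ red w₂ →
      G.Adj v w₁ → G.Adj v w₂ → w₁ = w₂) ∧
  (∀ v : V, red v → ∃ w : V, red w ∧ G.Adj v w) ∧
  (∀ a b c d : V, red a → red b → red c → red d →
      a ≠ c → a ≠ d → b ≠ d →
      ¬ (G.Adj a b ∧ G.Adj b c ∧ G.Adj c d))

/-- A graph is subcubic if every vertex has degree at most 3. -/
def Subcubic {V : Type*} (G : SimpleGraph V) : Prop :=
  ∀ v : V, (G.neighborSet v).encard ≤ 3

/-- Adjacency in the graph `H`: the 8-cycle `v₀v₁…v₇v₀` together with the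
two chords `v₂v₆` and `v₃v₇`. -/
def HAdj (i j : Fin 8) : Prop :=
  (j = i + 1 ∨ i = j + 1) ∨
  (i = 2 ∧ j = 6) ∨ (i = 6 ∧ j = 2) ∨ (i = 3 ∧ j = 7) ∨ (i = 7 ∧ j = 3)

/-- In a subcubic graph, three distinct neighbors of a vertex are all of its neighbors. -/
theorem Subcubic.eq_or_eq_or_eq_of_adj {V : Type*} {G : SimpleGraph V} (hG : Subcubic G)
    {u a b c w : V} (hab : a ≠ b) (hac : a ≠ c) (hbc : b ≠ c)
    (ha : G.Adj u a) (hb : G.Adj u b) (hc : G.Adj u c) (hw : G.Adj u w) :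
    w = a ∨ w = b ∨ w = c := by
  have hsub : ({a, b, c} : Set V) ⊆ G.neighborSet u := by
    rintro x (rfl | rfl | rfl) <;> assumption
  have hcard : ({a, b, c} : Set V).encard = 3 :=
    Set.encard_eq_three.2 ⟨a, b, c, hab, hac, hbc, rfl⟩
  have heq : ({a, b, c} : Set V) = G.neighborSet u :=
    (Set.toFinite _).eq_of_subset_of_encard_le hsub (hcard ▸ hG u)
  have hmem : w ∈ ({a, b, c} : Set V) := heq ▸ hw
  simpa using hmem

/-- In a good coloring of a subcubic graph, if two of three distinct neighbors of a red vertex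
are blue, then the third one is red. -/
theorem IsGoodColoring.red_of_adj {V : Type*} {G : SimpleGraph V} {red : V → Prop}
    (hgood : IsGoodColoring G red) (hG : Subcubic G) {u a b c : V}
    (hab : a ≠ b) (hac : a ≠ c) (hbc : b ≠ c)
    (ha : G.Adj u a) (hb : G.Adj u b) (hc : G.Adj u c)
    (hu : red u) (hra : ¬ red a) (hrb : ¬ red b) : red c := by
  obtain ⟨w, hw, huw⟩ := hgood.2.1 u hu
  rcases hG.eq_or_eq_or_eq_of_adj hab hac hbc ha hb hc huw with rfl | rfl | rfl
  · exact absurd hw hra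
  · exact absurd hw hrb
  · exact hw

/-- If `H` is an induced subgraph of a subcubic graph `G`, then in every good
coloring of `G` at most one of the vertices `v₀, v₁` is colored red. -/
theorem at_most_one_of_v0_v1_red {V : Type*} (G : SimpleGraph V)
    (hG : Subcubic G) (v : Fin 8 → V) (hinj : Function.Injective v)
    (hind : ∀ i j : Fin 8, G.Adj (v i) (v j) ↔ HAdj i j)
    (red : V → Prop) (hgood : IsGoodColoring G red) :
    ¬ (red (v 0) ∧ red (v 1)) := by
  rintro ⟨h0, h1⟩
  have ne {i j : Fin 8} (h : i ≠ j) : v i ≠ v j := hinj.ne h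
  have adj {i j : Fin 8} (h : (j = i + 1 ∨ i = j + 1) ∨ (i = 2 ∧ j = 6) ∨ (i = 6 ∧ j = 2) ∨
      (i = 3 ∧ j = 7) ∨ (i = 7 ∧ j = 3)) : G.Adj (v i) (v j) := (hind i j).2 h
  have blue {i j k : Fin 8} (hij : G.Adj (v i) (v j)) (hik : G.Adj (v i) (v k)) (hjk : j ≠ k)
      (hi : ¬ red (v i)) (hj : ¬ red (v j)) : red (v k) := by
    by_contra hk
    exact ne hjk (hgood.1 _ _ _ hi hj hk hij hik)
  have path {i j k l : Fin 8} (hik : i ≠ k) (hil : i ≠ l) (hjl : j ≠ l)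
      (hij : G.Adj (v i) (v j)) (hjk : G.Adj (v j) (v k)) (hkl : G.Adj (v k) (v l))
      (hi : red (v i)) (hj : red (v j)) (hk : red (v k)) : ¬ red (v l) := fun hl =>
    hgood.2.2 _ _ _ _ hi hj hk hl (ne hik) (ne hil) (ne hjl) ⟨hij, hjk, hkl⟩
  have a01 : G.Adj (v 0) (v 1) := adj (by decide)
  have a12 : G.Adj (v 1) (v 2) := adj (by decide)
  have a23 : G.Adj (v 2) (v 3) := adj (by decide)
  have a34 : G.Adj (v 3) (v 4) := adj (by decide)
  have a45 : G.Adj (v 4) (v 5) := adj (by decide)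
  have a56 : G.Adj (v 5) (v 6) := adj (by decide)
  have a67 : G.Adj (v 6) (v 7) := adj (by decide)
  have a70 : G.Adj (v 7) (v 0) := adj (by decide)
  have a26 : G.Adj (v 2) (v 6) := adj (by decide)
  have a37 : G.Adj (v 3) (v 7) := adj (by decide)
  by_cases h2 : red (v 2)
  · have h7 : ¬ red (v 7) :=
      path (by decide) (by decide) (by decide) a12.symm a01.symm a70.symm h2 h1 h0
    have h3 : ¬ red (v 3) :=
      path (by decide) (by decide) (by decide) a01 a12 a23 h0 h1 h2
    have h6 : ¬ red (v 6) :=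
      path (by decide) (by decide) (by decide) a01 a12 a26 h0 h1 h2
    exact h6 (blue a37.symm a67.symm (by decide) h7 h3)
  by_cases h7 : red (v 7)
  · have h3 : ¬ red (v 3) :=
      path (by decide) (by decide) (by decide) a01.symm a70.symm a37.symm h1 h0 h7
    have h6 : ¬ red (v 6) :=
      path (by decide) (by decide) (by decide) a01.symm a70.symm a67.symm h1 h0 h7
    exact h6 (blue a23 a26 (by decide) h2 h3)
  have h3 : red (v 3) := by
    by_contra h3
    exact h7 (blue a23.symm a37 (by decide) h3 h2)
  have h6 : red (v 6) := by
    by_contra h6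
    exact h7 (blue a26.symm a67 (by decide) h6 h2)
  have h4 : red (v 4) := hgood.red_of_adj hG (ne (by decide)) (ne (by decide)) (ne (by decide))
    a23.symm a37 a34 h3 h2 h7
  have h5 : red (v 5) := hgood.red_of_adj hG (ne (by decide)) (ne (by decide)) (ne (by decide))
    a26.symm a67 a56.symm h6 h2 h7
  exact path (by decide) (by decide) (by decide) a34 a45 a56 h3 h4 h5 h6
end

section
/- Let G be a subcubic simple graph and suppose H' is an induced subgraph of G, on vertices v0,...,v7,u0,...,u7. Then in every good coloring of G exactly one of the following three statements holds: (a) both v0 and v1 are colored blue; (b) v0 is colored red, v1 is colored blue, and v0 has a red neighbor in G that does not belong to H'; (c) v1 is colored red, v0 is colored blue, and v1 has a red neighbor in G that does not belong to H'. -/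
/-- Adjacency in the graph `H'`: two disjoint copies of `H` (copy `0` on the
`vᵢ`'s and copy `1` on the `uᵢ`'s), together with the joining edges
`v₄u₀` and `v₅u₁`.  Vertex `(c, i)` is vertex `i` of copy `c`. -/
def H'Adj (p q : Fin 2 × Fin 8) : Prop :=
  (p.1 = q.1 ∧ HAdj p.2 q.2) ∨
  (p = (0, 4) ∧ q = (1, 0)) ∨ (p = (1, 0) ∧ q = (0, 4)) ∨
  (p = (0, 5) ∧ q = (1, 1)) ∨ (p = (1, 1) ∧ q = (0, 5))

instance : DecidableRel HAdj := fun i j => by unfold HAdj; infer_instance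

instance : DecidableRel H'Adj := fun p q => by unfold H'Adj; infer_instance

/-- In a subcubic graph, three distinct neighbors of a vertex are all its neighbors. -/
lemma Subcubic.eq_of_adj {V : Type*} {G : SimpleGraph V} (hG : Subcubic G) {v a b c w : V}
    (hab : a ≠ b) (hac : a ≠ c) (hbc : b ≠ c) (ha : G.Adj v a) (hb : G.Adj v b) (hc : G.Adj v c)
    (hw : G.Adj v w) : w = a ∨ w = b ∨ w = c := by
  have hsub : ({a, b, c} : Set V) ⊆ G.neighborSet v := by
    rintro x (rfl | rfl | rfl) <;> assumption
  have hcard : ({a, b, c} : Set V).encard = 3 := by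
    rw [Set.encard_eq_three]
    exact ⟨a, b, c, hab, hac, hbc, rfl⟩
  have heq : ({a, b, c} : Set V) = G.neighborSet v :=
    (Set.toFinite _).eq_of_subset_of_encard_le hsub (hcard ▸ hG v)
  have hmem : w ∈ ({a, b, c} : Set V) := heq ▸ hw
  simpa using hmem

lemma H'Adj_copy : ∀ (k : Fin 2) (i j : Fin 8), H'Adj (k, i) (k, j) ↔ HAdj i j := by
  decide +kernel

/-- A coloring of `H` by Booleans (`true` is red) is *locally good* if it satisfies the
conditions of a good coloring, except that a red neighbor is demanded only for the vertices
`2, 3, 6, 7`, which have degree 3 in `H`. -/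
def LocallyGoodH (c : Fin 8 → Bool) : Prop :=
  (∀ v, c v = false → ∀ w, c w = false → HAdj v w → ∀ x, c x = false → HAdj v x → w = x) ∧
  (∀ v, v = 2 ∨ v = 3 ∨ v = 6 ∨ v = 7 → c v = true → ∃ w, c w = true ∧ HAdj v w) ∧
  (∀ x, c x = true → ∀ y, c y = true → HAdj x y → ∀ z, c z = true → HAdj y z → x ≠ z →
    ∀ w, c w = true → HAdj z w → x ≠ w → y = w)

set_option synthInstance.maxSize 1000 in
set_option synthInstance.maxHeartbeats 200000 in
instance : DecidablePred LocallyGoodH := fun c => by unfold LocallyGoodH; infer_instance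

lemma LocallyGoodH.boundary : ∀ b₀ b₁ b₂ b₃ b₄ b₅ b₆ b₇ : Bool,
    LocallyGoodH ![b₀, b₁, b₂, b₃, b₄, b₅, b₆, b₇] →
    ¬ (b₀ = true ∧ b₁ = true) ∧
      (b₄ = true ∨ b₅ = true → (b₀ = true → ¬ b₇ = true) ∧ (b₁ = true → ¬ b₂ = true)) := by
  decide +kernel

/-- Restriction of a good coloring to an induced copy of `H` in which the vertices `2, 3, 6, 7`
have no neighbors outside the copy. -/
lemma IsGoodColoring.induced_H {V : Type*} {G : SimpleGraph V} {red : V → Prop}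
    (hgood : IsGoodColoring G red) {g : Fin 8 → V} (hinj : Function.Injective g)
    (hind : ∀ i j, G.Adj (g i) (g j) ↔ HAdj i j)
    (hclosed : ∀ i, i = 2 ∨ i = 3 ∨ i = 6 ∨ i = 7 → ∀ w, G.Adj (g i) w → w ∈ Set.range g) :
    ¬ (red (g 0) ∧ red (g 1)) ∧
      (red (g 4) ∨ red (g 5) → (red (g 0) → ¬ red (g 7)) ∧ (red (g 1) → ¬ red (g 2))) := by
  classical
  obtain ⟨hblue, hred, hpath⟩ := hgood
  let c : Fin 8 → Bool := fun i => decide (red (g i))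
  have hc : ![c 0, c 1, c 2, c 3, c 4, c 5, c 6, c 7] = c := by
    ext i; fin_cases i <;> rfl
  have key := LocallyGoodH.boundary (c 0) (c 1) (c 2) (c 3) (c 4) (c 5) (c 6) (c 7)
  rw [hc] at key
  simp only [LocallyGoodH, c, decide_eq_true_eq, decide_eq_false_iff_not, ← hind] at key
  refine key ⟨?_, ?_, ?_⟩
  · intro v hv w hw hvw x hx hvx
    exact hinj (hblue _ _ _ hv hw hx hvw hvx)
  · intro v hv hrv
    obtain ⟨w, hw, hvw⟩ := hred _ hrv
    obtain ⟨i, rfl⟩ := hclosed v hv w hvw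
    exact ⟨i, hw, hvw⟩
  · intro x hx y hy hxy z hz hyz hxz w hw hzw hxw
    by_contra hyw
    exact hpath _ _ _ _ hx hy hz hw (hinj.ne hxz) (hinj.ne hxw) (hinj.ne hyw) ⟨hxy, hyz, hzw⟩

/-- If `H'` is an induced subgraph of a subcubic graph `G` (via the embedding
`f`, so that `v₀ = f (0,0)` and `v₁ = f (0,1)` are the distinguished
vertices), then in every good coloring of `G` exactly one of the following
holds: (a) both `v₀, v₁` are blue; (b) `v₀` is red, `v₁` is blue and `v₀` has
a red neighbor outside `H'`; (c) `v₁` is red, `v₀` is blue and `v₁` has a red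
neighbor outside `H'`. -/
theorem H'_trichotomy {V : Type*} (G : SimpleGraph V)
    (hG : Subcubic G) (f : Fin 2 × Fin 8 → V) (hinj : Function.Injective f)
    (hind : ∀ p q : Fin 2 × Fin 8, G.Adj (f p) (f q) ↔ H'Adj p q)
    (red : V → Prop) (hgood : IsGoodColoring G red) :
    ((¬ red (f (0, 0)) ∧ ¬ red (f (0, 1))) ∧
      ¬ (red (f (0, 0)) ∧ ¬ red (f (0, 1)) ∧
          ∃ w : V, red w ∧ G.Adj (f (0, 0)) w ∧ w ∉ Set.range f) ∧
      ¬ (red (f (0, 1)) ∧ ¬ red (f (0, 0)) ∧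
          ∃ w : V, red w ∧ G.Adj (f (0, 1)) w ∧ w ∉ Set.range f)) ∨
    ((red (f (0, 0)) ∧ ¬ red (f (0, 1)) ∧
        ∃ w : V, red w ∧ G.Adj (f (0, 0)) w ∧ w ∉ Set.range f) ∧
      ¬ (¬ red (f (0, 0)) ∧ ¬ red (f (0, 1))) ∧
      ¬ (red (f (0, 1)) ∧ ¬ red (f (0, 0)) ∧
          ∃ w : V, red w ∧ G.Adj (f (0, 1)) w ∧ w ∉ Set.range f)) ∨
    ((red (f (0, 1)) ∧ ¬ red (f (0, 0)) ∧
        ∃ w : V, red w ∧ G.Adj (f (0, 1)) w ∧ w ∉ Set.range f) ∧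
      ¬ (¬ red (f (0, 0)) ∧ ¬ red (f (0, 1))) ∧
      ¬ (red (f (0, 0)) ∧ ¬ red (f (0, 1)) ∧
          ∃ w : V, red w ∧ G.Adj (f (0, 0)) w ∧ w ∉ Set.range f)) := by
  have ⟨hblue, hred, _⟩ := hgood
  have hcopy (k : Fin 2) := hgood.induced_H (g := fun i => f (k, i))
    (fun i j h => by simpa using hinj h) (fun i j => (hind _ _).trans (H'Adj_copy k i j))
    (by
      have hnbr : ∀ i : Fin 8, i = 2 ∨ i = 3 ∨ i = 6 ∨ i = 7 → ∃ x y z, x ≠ y ∧ x ≠ z ∧ y ≠ z ∧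
          HAdj i x ∧ HAdj i y ∧ HAdj i z := by decide
      intro i hi w hw
      obtain ⟨x, y, z, hxy, hxz, hyz, hx, hy, hz⟩ := hnbr i hi
      have hadj {j : Fin 8} (h : HAdj i j) : G.Adj (f (k, i)) (f (k, j)) :=
        (hind _ _).2 (Or.inl ⟨rfl, h⟩)
      have hne {j l : Fin 8} (h : j ≠ l) : f (k, j) ≠ f (k, l) := hinj.ne (by simpa using h)
      rcases hG.eq_of_adj (hne hxy) (hne hxz) (hne hyz) (hadj hx) (hadj hy) (hadj hz) hw with
        rfl | rfl | rfl
      exacts [⟨x, rfl⟩, ⟨y, rfl⟩, ⟨z, rfl⟩])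
  have h45 : red (f (0, 4)) ∨ red (f (0, 5)) := by
    by_contra! h
    refine (hcopy 1).1 ⟨?_, ?_⟩ <;> by_contra hu
    · exact absurd (hinj (hblue _ _ _ h.1 h.2 hu ((hind _ _).2 (by decide))
        ((hind _ _).2 (by decide)))) (by decide)
    · exact absurd (hinj (hblue _ _ _ h.2 h.1 hu ((hind _ _).2 (by decide))
        ((hind _ _).2 (by decide)))) (by decide)
  obtain ⟨h01, h⟩ := hcopy 0
  obtain ⟨h07, h12⟩ := h h45
  have hout₀ (h₀ : red (f (0, 0))) : ∃ w, red w ∧ G.Adj (f (0, 0)) w ∧ w ∉ Set.range f := by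
    obtain ⟨w, hw, hadj⟩ := hred _ h₀
    refine ⟨w, hw, hadj, ?_⟩
    rintro ⟨p, rfl⟩
    have hp : ∀ p, H'Adj (0, 0) p → p = (0, 1) ∨ p = (0, 7) := by decide
    rcases hp p ((hind _ _).1 hadj) with rfl | rfl
    exacts [h01 ⟨h₀, hw⟩, h07 h₀ hw]
  have hout₁ (h₁ : red (f (0, 1))) : ∃ w, red w ∧ G.Adj (f (0, 1)) w ∧ w ∉ Set.range f := by
    obtain ⟨w, hw, hadj⟩ := hred _ h₁
    refine ⟨w, hw, hadj, ?_⟩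
    rintro ⟨p, rfl⟩
    have hp : ∀ p, H'Adj (0, 1) p → p = (0, 0) ∨ p = (0, 2) := by decide
    rcases hp p ((hind _ _).1 hadj) with rfl | rfl
    exacts [h01 ⟨hw, h₁⟩, h12 h₁ hw]
  by_cases h₀ : red (f (0, 0))
  · have h₁ : ¬ red (f (0, 1)) := fun h₁ => h01 ⟨h₀, h₁⟩
    exact Or.inr (Or.inl ⟨⟨h₀, h₁, hout₀ h₀⟩, fun h => h.1 h₀, fun h => h.2.1 h₀⟩)
  by_cases h₁ : red (f (0, 1))
  · exact Or.inr (Or.inr ⟨⟨h₁, h₀, hout₁ h₁⟩, fun h => h.2 h₁, fun h => h.2.1 h₁⟩)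
  · exact Or.inl ⟨⟨h₀, h₁⟩, fun h => h₀ h.1, fun h => h₁ h.1⟩
end

section
/- If a subcubic simple graph G contains H'' as a subgraph, then G has no good coloring. -/
/-- Adjacency in the graph `H''`: three disjoint copies of `H'` (indexed by
`Fin 3`) together with the three joining edges connecting the distinguished
vertex `v₁ = (0,1)` of copy `i` to the distinguished vertex `v₀ = (0,0)` of
copy `i+1`, so that the six distinguished vertices form a 6-cycle meeting
all three copies of `H'`. -/
def H''Adj (p q : Fin 3 × Fin 2 × Fin 8) : Prop :=
  (p.1 = q.1 ∧ H'Adj p.2 q.2) ∨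
  (p.2 = (0, 1) ∧ q.2 = (0, 0) ∧ q.1 = p.1 + 1) ∨
  (p.2 = (0, 0) ∧ q.2 = (0, 1) ∧ p.1 = q.1 + 1)

instance inst_s3 : DecidableRel HAdj := fun _ _ => inferInstanceAs (Decidable (_ ∨ _))

instance inst_s3_2 : DecidableRel H'Adj := fun _ _ => inferInstanceAs (Decidable (_ ∨ _))

instance : DecidableRel H''Adj := fun _ _ => inferInstanceAs (Decidable (_ ∨ _))

section GoodColoring

variable {V : Type*} {G : SimpleGraph V} {red : V → Prop}

/-- In a good coloring, a vertex and two of its neighbors are not all blue. -/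
lemma IsGoodColoring.red_or_red_or_red (h : IsGoodColoring G red) {v a b : V}
    (ha : G.Adj v a) (hb : G.Adj v b) (hab : a ≠ b) : red v ∨ red a ∨ red b := by
  by_contra! hc
  exact hab (h.1 v a b hc.1 hc.2.1 hc.2.2 ha hb)

/-- Three distinct neighbors of a vertex of a subcubic graph are all of its neighbors. -/
lemma Subcubic.eq_or_eq_or_eq (hG : Subcubic G) {v a b c w : V}
    (ha : G.Adj v a) (hb : G.Adj v b) (hc : G.Adj v c)
    (hab : a ≠ b) (hac : a ≠ c) (hbc : b ≠ c) (hw : G.Adj v w) :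
    w = a ∨ w = b ∨ w = c := by
  have hcard : ({a, b, c} : Set V).encard = 3 :=
    Set.encard_eq_three.2 ⟨a, b, c, hab, hac, hbc, rfl⟩
  have hsub : ({a, b, c} : Set V) ⊆ G.neighborSet v := by
    rintro x (rfl | rfl | rfl) <;> assumption
  have hfin : ({a, b, c} : Set V).Finite := Set.toFinite _
  have heq := hfin.eq_of_subset_of_encard_le hsub (hcard ▸ hG v)
  have hmem : w ∈ ({a, b, c} : Set V) := heq ▸ hw
  simpa using hmem

/-- In a good coloring of a subcubic graph, a red vertex with three given neighbors has a red
vertex among them. -/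
lemma IsGoodColoring.red_or_red_or_red_of_red (h : IsGoodColoring G red) (hG : Subcubic G)
    {v a b c : V} (ha : G.Adj v a) (hb : G.Adj v b) (hc : G.Adj v c)
    (hab : a ≠ b) (hac : a ≠ c) (hbc : b ≠ c) (hv : red v) : red a ∨ red b ∨ red c := by
  obtain ⟨w, hw, hvw⟩ := h.2.1 v hv
  rcases hG.eq_or_eq_or_eq ha hb hc hab hac hbc hvw with rfl | rfl | rfl <;> simp [hw]

/-- The family `v` spans a (not necessarily induced) copy of `H` in `G`. -/
structure IsHCopy (G : SimpleGraph V) (v : Fin 8 → V) : Prop where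
  injective : Function.Injective v
  adj : ∀ {i j}, HAdj i j → G.Adj (v i) (v j)

namespace IsHCopy

variable {v : Fin 8 → V}

/-- The reflection of `H` exchanging its distinguished vertices. -/
lemma reflect (hv : IsHCopy G v) : IsHCopy G fun i => v (1 - i) where
  injective := hv.injective.comp sub_right_injective
  adj {i j} hij := hv.adj <| by revert i j; decide

lemma not_all_blue (hv : IsHCopy G v) (h : IsGoodColoring G red) (i j k : Fin 8)
    (hijk : HAdj i j ∧ HAdj i k ∧ j ≠ k) : red (v i) ∨ red (v j) ∨ red (v k) :=
  h.red_or_red_or_red (hv.adj hijk.1) (hv.adj hijk.2.1) (hv.injective.ne hijk.2.2)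

lemma no_red_path (hv : IsHCopy G v) (h : IsGoodColoring G red) (i j k l : Fin 8)
    (hadj : HAdj i j ∧ HAdj j k ∧ HAdj k l) (hne : i ≠ k ∧ i ≠ l ∧ j ≠ l) :
    ¬ (red (v i) ∧ red (v j) ∧ red (v k) ∧ red (v l)) := fun ⟨hi, hj, hk, hl⟩ =>
  h.2.2 _ _ _ _ hi hj hk hl (hv.injective.ne hne.1) (hv.injective.ne hne.2.1)
    (hv.injective.ne hne.2.2) ⟨hv.adj hadj.1, hv.adj hadj.2.1, hv.adj hadj.2.2⟩

lemma exists_red_neighbor (hv : IsHCopy G v) (h : IsGoodColoring G red) (hG : Subcubic G)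
    (i j k l : Fin 8) (hadj : HAdj i j ∧ HAdj i k ∧ HAdj i l) (hne : j ≠ k ∧ j ≠ l ∧ k ≠ l) :
    red (v i) → red (v j) ∨ red (v k) ∨ red (v l) :=
  h.red_or_red_or_red_of_red hG (hv.adj hadj.1) (hv.adj hadj.2.1) (hv.adj hadj.2.2)
    (hv.injective.ne hne.1) (hv.injective.ne hne.2.1) (hv.injective.ne hne.2.2)

/-- The distinguished vertices of a copy of `H` are not both red. -/
lemma not_red_zero_and_red_one (hv : IsHCopy G v) (h : IsGoodColoring G red)
    (hG : Subcubic G) : ¬ (red (v 0) ∧ red (v 1)) := by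
  have := hv.not_all_blue h 2 3 6 (by decide)
  have := hv.not_all_blue h 3 2 7 (by decide)
  have := hv.not_all_blue h 6 7 2 (by decide)
  have := hv.not_all_blue h 7 6 3 (by decide)
  have := hv.no_red_path h 0 1 2 3 (by decide) (by decide)
  have := hv.no_red_path h 0 1 2 6 (by decide) (by decide)
  have := hv.no_red_path h 1 0 7 3 (by decide) (by decide)
  have := hv.no_red_path h 1 0 7 6 (by decide) (by decide)
  have := hv.no_red_path h 2 1 0 7 (by decide) (by decide)
  have := hv.no_red_path h 3 4 5 6 (by decide) (by decide)
  have := hv.exists_red_neighbor h hG 3 2 4 7 (by decide) (by decide)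
  have := hv.exists_red_neighbor h hG 6 5 7 2 (by decide) (by decide)
  grind

/-- If the outer neighbors `p` of `v 4` and `q` of `v 5` are not both red, then `v 7` is not a red
neighbor of a red `v 0`. -/
lemma not_red_seven (hv : IsHCopy G v) (h : IsGoodColoring G red) (hG : Subcubic G) {p q : V}
    (hp : G.Adj (v 4) p) (hq : G.Adj (v 5) q) (hp5 : p ≠ v 5) (hq4 : q ≠ v 4)
    (hpq : ¬ (red p ∧ red q)) (h0 : red (v 0)) : ¬ red (v 7) := by
  have := hv.not_red_zero_and_red_one h hG
  have := hv.not_all_blue h 2 1 3 (by decide)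
  have := hv.not_all_blue h 2 1 6 (by decide)
  have := h.red_or_red_or_red (hv.adj (i := 4) (j := 5) (by decide)) hp hp5.symm
  have := h.red_or_red_or_red (hv.adj (i := 5) (j := 4) (by decide)) hq hq4.symm
  have := hv.no_red_path h 0 7 3 2 (by decide) (by decide)
  have := hv.no_red_path h 0 7 6 2 (by decide) (by decide)
  have := hv.no_red_path h 3 7 6 5 (by decide) (by decide)
  have := hv.no_red_path h 4 3 7 6 (by decide) (by decide)
  have := hv.exists_red_neighbor h hG 2 1 3 6 (by decide) (by decide)
  grind

/-- Mirror image of `IsHCopy.not_red_seven`. -/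
lemma not_red_two (hv : IsHCopy G v) (h : IsGoodColoring G red) (hG : Subcubic G) {p q : V}
    (hp : G.Adj (v 4) p) (hq : G.Adj (v 5) q) (hp5 : p ≠ v 5) (hq4 : q ≠ v 4)
    (hpq : ¬ (red p ∧ red q)) (h1 : red (v 1)) : ¬ red (v 2) :=
  hv.reflect.not_red_seven h hG hq hp hq4 hp5 (fun hqp => hpq hqp.symm) h1

end IsHCopy

end GoodColoring

/-- If a subcubic simple graph `G` contains `H''` as a subgraph,
then `G` has no good coloring. -/
theorem no_good_coloring_of_H''_subgraph {V : Type*} (G : SimpleGraph V)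
    (hG : Subcubic G) (f : Fin 3 × Fin 2 × Fin 8 → V)
    (hinj : Function.Injective f)
    (hsub : ∀ p q : Fin 3 × Fin 2 × Fin 8, H''Adj p q → G.Adj (f p) (f q)) :
    ¬ ∃ red : V → Prop, IsGoodColoring G red := by
  rintro ⟨red, h⟩
  have hcopy (i : Fin 3) (c : Fin 2) : IsHCopy G fun j => f (i, c, j) :=
    ⟨fun j k hjk => by simpa using hinj hjk,
      fun hjk => hsub _ _ (Or.inl ⟨rfl, Or.inl ⟨rfl, hjk⟩⟩)⟩
  have hp (i : Fin 3) : G.Adj (f (i, 0, 4)) (f (i, 1, 0)) :=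
    hsub _ _ (by revert i; decide)
  have hq (i : Fin 3) : G.Adj (f (i, 0, 5)) (f (i, 1, 1)) :=
    hsub _ _ (by revert i; decide)
  have hnot (i : Fin 3) (c : Fin 2) : ¬ (red (f (i, c, 0)) ∧ red (f (i, c, 1))) :=
    (hcopy i c).not_red_zero_and_red_one h hG
  have hlink (i : Fin 3) : G.Adj (f (i, 0, 1)) (f (i + 1, 0, 0)) :=
    hsub _ _ (Or.inr (Or.inl ⟨rfl, rfl, rfl⟩))
  have hne {i j : Fin 3} {k l : Fin 8} (hkl : k ≠ l) : f (i, 0, k) ≠ f (j, 0, l) :=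
    hinj.ne (by simp [hkl])
  have hne' {i : Fin 3} {k l : Fin 8} : f (i, 1, k) ≠ f (i, 0, l) := hinj.ne (by simp)
  -- The joining edge leaving a red distinguished vertex ends in a red vertex.
  have hnext (i : Fin 3) (h1 : red (f (i, 0, 1))) : red (f (i + 1, 0, 0)) := by
    have h2 := (hcopy i 0).not_red_two h hG (hp i) (hq i) hne' hne' (hnot i 1) h1
    have := h.red_or_red_or_red_of_red hG ((hcopy i 0).adj (i := 1) (j := 0) (by decide))
      ((hcopy i 0).adj (i := 1) (j := 2) (by decide)) (hlink i) (hne (by decide))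
      (hinj.ne (by simp)) (hne (by decide)) h1
    have := hnot i 0
    tauto
  have hprev (i : Fin 3) (h0 : red (f (i + 1, 0, 0))) : red (f (i, 0, 1)) := by
    have h7 := (hcopy (i + 1) 0).not_red_seven h hG (hp _) (hq _) hne' hne' (hnot _ 1) h0
    have := h.red_or_red_or_red_of_red hG ((hcopy (i + 1) 0).adj (i := 0) (j := 1) (by decide))
      ((hcopy (i + 1) 0).adj (i := 0) (j := 7) (by decide)) (hlink i).symm (hne (by decide))
      (hinj.ne (by simp)) (hne (by decide)) h0
    have := hnot (i + 1) 0
    tauto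
  have hsome (i : Fin 3) : red (f (i, 0, 0)) ∨ red (f (i, 0, 1)) := by
    have := h.red_or_red_or_red ((hcopy i 0).adj (i := 1) (j := 0) (by decide)) (hlink i)
      (hinj.ne (by simp))
    have := hprev i
    tauto
  -- Hence the color of `v₀` alternates around a cycle of three copies.
  have halt (i : Fin 3) : red (f (i + 1, 0, 0)) ↔ ¬ red (f (i, 0, 0)) :=
    ⟨fun h0 h0' => hnot i 0 ⟨h0', hprev i h0⟩, fun h0 => hnext i ((hsome i).resolve_left h0)⟩
  have h01 := halt 0
  have h12 := halt 1
  have h20 := halt 2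
  simp only [Fin.isValue, zero_add, Fin.reduceAdd] at h01 h12 h20
  tauto
end

section
/- The 3-prism, i.e., the graph consisting of two disjoint triangles a0a1a2 and b0b1b2 together with the three edges a0b0, a1b1, a2b2 (equivalently, the Cartesian product of K3 and K2), has no good coloring. -/
/-- The 3-prism: two disjoint triangles `a₀a₁a₂` (vertices `(i, 0)`) and
`b₀b₁b₂` (vertices `(i, 1)`) together with the edges `aᵢbᵢ`; equivalently the
Cartesian product of `K₃` and `K₂`.  (The relation below is symmetric and
irreflexive, so `SimpleGraph.fromRel` yields exactly this graph.) -/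
def Prism : SimpleGraph (Fin 3 × Fin 2) :=
  SimpleGraph.fromRel
    (fun p q => (p.1 = q.1 ∧ p.2 ≠ q.2) ∨ (p.2 = q.2 ∧ p.1 ≠ q.1))

theorem prism_adj_iff (p q : Fin 3 × Fin 2) :
    Prism.Adj p q ↔ (p.1 = q.1 ∧ p.2 ≠ q.2) ∨ (p.2 = q.2 ∧ p.1 ≠ q.1) := by
  simp only [Prism, SimpleGraph.fromRel_adj]
  grind

/-- In a good coloring no triangle of the prism is entirely red: a red vertex of the other
triangle would complete a red path on 4 vertices, so the other triangle would be blue. -/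
theorem IsGoodColoring.not_red_triangle {red : Fin 3 × Fin 2 → Prop}
    (h : IsGoodColoring Prism red) (s : Fin 2) : ¬ ∀ i, red (i, s) := by
  intro hs
  obtain ⟨hblue, -, hpath⟩ := h
  have other : ∀ i, ¬ red (i, s + 1) := by
    intro i hi
    refine hpath (i, s + 1) (i, s) (i + 1, s) (i + 2, s) hi (hs _) (hs _) (hs _) ?_ ?_ ?_ ?_ <;>
      simp [prism_adj_iff]
  have := hblue (0, s + 1) (1, s + 1) (2, s + 1) (other _) (other _) (other _)
    (by simp [prism_adj_iff]) (by simp [prism_adj_iff])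
  simp at this

/-- In a good coloring no triangle of the prism has two blue vertices: their partners would be
red, and the red neighbor of the third vertex would make the other triangle red. -/
theorem IsGoodColoring.red_of_not_red {red : Fin 3 × Fin 2 → Prop}
    (h : IsGoodColoring Prism red) {s : Fin 2} {i j : Fin 3} (hij : i ≠ j)
    (hi : ¬ red (i, s)) : red (j, s) := by
  by_contra hj
  have hno := h.not_red_triangle (s + 1)
  obtain ⟨hblue, hred, -⟩ := h
  simp only [prism_adj_iff] at hblue hred
  have hi' : red (i, s + 1) := by
    by_contra hc
    have := hblue (i, s) (j, s) (i, s + 1) hi hj hc (by grind -ring) (by simp)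
    grind -ring
  have hj' : red (j, s + 1) := by
    by_contra hc
    have := hblue (j, s) (i, s) (j, s + 1) hj hi hc (by grind -ring) (by simp)
    grind -ring
  obtain ⟨k, hk⟩ := not_forall.mp hno
  have hk_red : red (k, s) := by
    by_contra hc
    have := hblue (i, s) (j, s) (k, s) hi hj hc (by grind -ring) (by grind -ring)
    grind -ring
  obtain ⟨⟨l, t⟩, hl, hadj⟩ := hred _ hk_red
  have hcases : (l, t) = (i, s) ∨ (l, t) = (j, s) ∨ (l, t) = (k, s + 1) := by
    have hki : k ≠ i := by grind -ring
    have hkj : k ≠ j := by grind -ring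
    clear * - hij hki hkj hadj
    revert i j k l s t
    decide
  grind -ring

/-- The 3-prism has no good coloring. -/
theorem prism_no_good_coloring :
    ¬ ∃ red : Fin 3 × Fin 2 → Prop, IsGoodColoring Prism red := by
  rintro ⟨red, h⟩
  obtain ⟨i, hi⟩ := not_forall.mp (h.not_red_triangle 0)
  obtain ⟨j, hj⟩ := not_forall.mp (h.not_red_triangle 1)
  -- A vertex `k` whose two copies are both red is the middle of a red path.
  obtain ⟨k, l, m, hki, hkj, hli, hlk, hmj, hmk⟩ :
      ∃ k l m : Fin 3, i ≠ k ∧ j ≠ k ∧ i ≠ l ∧ l ≠ k ∧ j ≠ m ∧ m ≠ k := by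
    clear hi hj
    revert i j
    decide
  refine h.2.2 (l, 0) (k, 0) (k, 1) (m, 1) (h.red_of_not_red hli hi) (h.red_of_not_red hki hi)
    (h.red_of_not_red hkj hj) (h.red_of_not_red hmj hj) (by simp) (by simp) (by simp) ?_
  simp only [prism_adj_iff]
  grind
end
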